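/- For an irreducible matrix A₀ of size m×n, an irreducible matrix B₀ of size p×q, positive integers s, t, p', q', and with R = lcm(n,m), T = lcm(ns, pp'), one has (A₀⊗I_s) ⊞ (B₀⊗I_{p'}) = (A₀⊗I_{R/n} + B₀⊗I_{R/m}) ⊗ I_{T/R}. -/

import Mathlib

/-- The collection of all finite-dimensional real matrices. -/
def MatR := Σ m n : ℕ, Matrix (Fin m) (Fin n) ℝ

/-- Kronecker product of real matrices with `Fin` index flattening. -/
def kron {m n p q : ℕ} (A : Matrix (Fin m) (Fin n) ℝ) (B : Matrix (Fin p) (Fin q) ℝ) :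
    Matrix (Fin (m * p)) (Fin (n * q)) ℝ :=
  Matrix.reindex finProdFinEquiv finProdFinEquiv (Matrix.kroneckerMap (· * ·) A B)

/-- `A ⊗ I_s` as an element of `MatR`. -/
def padK (A : MatR) (s : ℕ) : MatR :=
  ⟨A.1 * s, A.2.1 * s, kron A.2.2 (1 : Matrix (Fin s) (Fin s) ℝ)⟩

/-- Left identity equivalence: `A ∼ B` iff `A ⊗ I_s = B ⊗ I_t` for some positive `s, t`. -/
def lie (A B : MatR) : Prop :=
  ∃ s t : ℕ, 0 < s ∧ 0 < t ∧ HEq (padK A s).2.2 (padK B t).2.2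

/-- A matrix, viewed as a function `ℕ → ℕ → ℝ` vanishing outside its index range. -/
def toFun (A : MatR) : ℕ → ℕ → ℝ := fun i j =>
  if hi : i < A.1 then if hj : j < A.2.1 then A.2.2 ⟨i, hi⟩ ⟨j, hj⟩ else 0 else 0

/-- The left semi-tensor addition `A ⊞ B := (A ⊗ I_{t/m}) + (B ⊗ I_{t/p})`, where `m, p`
are the row numbers of `A, B` and `t = lcm m p`.  (For matrices with equal row/column
ratio this agrees with the usual definition.) -/
def staM (A B : MatR) : MatR :=
  ⟨Nat.lcm A.1 B.1, A.2.1 * (Nat.lcm A.1 B.1 / A.1),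
    Matrix.of fun i j =>
      toFun (padK A (Nat.lcm A.1 B.1 / A.1)) i.1 j.1 +
        toFun (padK B (Nat.lcm A.1 B.1 / B.1)) i.1 j.1⟩

/-- Entrywise scalar multiple. -/
def smulM (c : ℝ) (A : MatR) : MatR := ⟨A.1, A.2.1, c • A.2.2⟩

/-- The left semi-tensor product `A ⋉ B := (A ⊗ I_{T/n})(B ⊗ I_{T/p})`, `T = lcm n p`
with `n` the column number of `A` and `p` the row number of `B`. -/
def stpM (A B : MatR) : MatR :=
  ⟨A.1 * (Nat.lcm A.2.1 B.1 / A.2.1), B.2.1 * (Nat.lcm A.2.1 B.1 / B.1),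
    Matrix.of fun i j =>
      ∑ k ∈ Finset.range (Nat.lcm A.2.1 B.1),
        toFun (padK A (Nat.lcm A.2.1 B.1 / A.2.1)) i.1 k *
          toFun (padK B (Nat.lcm A.2.1 B.1 / B.1)) k j.1⟩

/-- A matrix is reducible if it is of the form `B ⊗ I_s` with `s ≥ 2`. -/
def reducibleM (A : MatR) : Prop := ∃ (B : MatR) (s : ℕ), 2 ≤ s ∧ A = padK B s

/-- Recasting a matrix along equalities of its dimensions. -/
def castM {m n m' n' : ℕ} (hm : m = m') (hn : n = n') (A : Matrix (Fin m) (Fin n) ℝ) :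
    Matrix (Fin m') (Fin n') ℝ :=
  Matrix.reindex (finCongr hm) (finCongr hn) A

/-- A matrix with its dimensions, as an element of `MatR`. -/
def MatR.ofMatrix {m n : ℕ} (A : Matrix (Fin m) (Fin n) ℝ) : MatR := ⟨m, n, A⟩

theorem MatR.ext_toFun {A B : MatR} (hr : A.1 = B.1) (hc : A.2.1 = B.2.1)
    (h : ∀ i < A.1, ∀ j < A.2.1, toFun A i j = toFun B i j) : A = B := by
  obtain ⟨m, n, A⟩ := A
  obtain ⟨m', n', B⟩ := B
  dsimp only at hr hc
  subst hr hc
  congr 2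
  ext i j
  simpa [toFun] using h i i.2 j j.2

theorem toFun_padK (A : MatR) {k : ℕ} (hk : 0 < k) (i j : ℕ) :
    toFun (padK A k) i j = if i % k = j % k then toFun A (i / k) (j / k) else 0 := by
  have hlt (x m : ℕ) : x < m * k ↔ x / k < m := (Nat.div_lt_iff_lt_mul hk).symm
  by_cases hi : i / k < A.1 <;> by_cases hj : j / k < A.2.1 <;>
    simp [toFun, padK, hlt, hi, hj, kron, Matrix.one_apply, Fin.divNat, Fin.modNat]

theorem padK_padK (A : MatR) {s k : ℕ} (hs : 0 < s) (hk : 0 < k) :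
    padK (padK A s) k = padK A (s * k) := by
  refine MatR.ext_toFun (Nat.mul_assoc ..) (Nat.mul_assoc ..) fun i _ j _ => ?_
  rw [toFun_padK _ hk, toFun_padK _ hs, toFun_padK _ (Nat.mul_pos hs hk), Nat.mul_comm s k,
    ← Nat.div_div_eq_div_mul, ← Nat.div_div_eq_div_mul, ← ite_and]
  refine if_congr ⟨fun ⟨h, h'⟩ => by rw [Nat.mod_mul, Nat.mod_mul, h, h'], fun h => ⟨?_, ?_⟩⟩ rfl rfl
  · simpa using congrArg (· % k) h
  · rw [← Nat.mod_mul_right_div_self, h, Nat.mod_mul_right_div_self]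

theorem toFun_add {m n : ℕ} (A B : Matrix (Fin m) (Fin n) ℝ) (i j : ℕ) :
    toFun (.ofMatrix (A + B)) i j = toFun (.ofMatrix A) i j + toFun (.ofMatrix B) i j := by
  by_cases hi : i < m <;> by_cases hj : j < n <;> simp [toFun, MatR.ofMatrix, hi, hj]

theorem ofMatrix_castM {m n m' n' : ℕ} (hm : m = m') (hn : n = n') (A : Matrix (Fin m) (Fin n) ℝ) :
    MatR.ofMatrix (castM hm hn A) = .ofMatrix A := by
  subst hm hn
  rfl

theorem toFun_padK_add {m n : ℕ} (A B : Matrix (Fin m) (Fin n) ℝ) {k : ℕ} (hk : 0 < k) (i j : ℕ) :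
    toFun (padK (.ofMatrix (A + B)) k) i j =
      toFun (padK (.ofMatrix A) k) i j + toFun (padK (.ofMatrix B) k) i j := by
  simp only [toFun_padK _ hk, toFun_add]
  split_ifs <;> simp

theorem toFun_staM (A B : MatR) {i j : ℕ} (hi : i < (staM A B).1) (hj : j < (staM A B).2.1) :
    toFun (staM A B) i j =
      toFun (padK A (Nat.lcm A.1 B.1 / A.1)) i j +
        toFun (padK B (Nat.lcm A.1 B.1 / B.1)) i j := by
  rw [toFun, dif_pos hi, dif_pos hj]
  rfl

theorem lcm_mul_eq_of_ratio {a n b m : ℕ} (hratio : a * m = b * n) (s p : ℕ) :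
    Nat.lcm (a * s) (b * p) * n = a * Nat.lcm (n * s) (m * p) := by
  rw [← Nat.lcm_mul_right, ← Nat.lcm_mul_left]
  congr 1
  · ring
  · rw [← mul_assoc, hratio]
    ring

/-- key identity (2.605): for `A₀ : (μn)×n`, `B₀ : (μm)×m` and positive
integers `s, p`, with `R = lcm n m` and `T = lcm (ns) (mp)`,
`(A₀ ⊗ I_s) ⊞ (B₀ ⊗ I_p) = (A₀ ⊗ I_{R/n} + B₀ ⊗ I_{R/m}) ⊗ I_{T/R}`. -/
theorem staM_padK_eq (a n b m : ℕ) (ha : 0 < a) (hn : 0 < n) (hb : 0 < b) (hm : 0 < m)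
    (hratio : a * m = b * n) (s p : ℕ) (hs : 0 < s) (hp : 0 < p)
    (A₀ : Matrix (Fin a) (Fin n) ℝ) (B₀ : Matrix (Fin b) (Fin m) ℝ)
    (h1 : b * (Nat.lcm n m / m) = a * (Nat.lcm n m / n))
    (h2 : m * (Nat.lcm n m / m) = n * (Nat.lcm n m / n)) :
    staM ⟨a * s, n * s, kron A₀ (1 : Matrix (Fin s) (Fin s) ℝ)⟩
        ⟨b * p, m * p, kron B₀ (1 : Matrix (Fin p) (Fin p) ℝ)⟩ =
      ⟨a * (Nat.lcm n m / n) * (Nat.lcm (n * s) (m * p) / Nat.lcm n m),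
        n * (Nat.lcm n m / n) * (Nat.lcm (n * s) (m * p) / Nat.lcm n m),
        kron
          (kron A₀ (1 : Matrix (Fin (Nat.lcm n m / n)) (Fin (Nat.lcm n m / n)) ℝ) +
            castM h1 h2
              (kron B₀ (1 : Matrix (Fin (Nat.lcm n m / m)) (Fin (Nat.lcm n m / m)) ℝ)))
          (1 : Matrix (Fin (Nat.lcm (n * s) (m * p) / Nat.lcm n m))
            (Fin (Nat.lcm (n * s) (m * p) / Nat.lcm n m)) ℝ)⟩ := by
  have hR : 0 < Nat.lcm n m := Nat.lcm_pos hn hm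
  have hT : 0 < Nat.lcm (n * s) (m * p) := Nat.lcm_pos (by positivity) (by positivity)
  have hL : 0 < Nat.lcm (a * s) (b * p) := Nat.lcm_pos (by positivity) (by positivity)
  have hRT : Nat.lcm n m ∣ Nat.lcm (n * s) (m * p) :=
    Nat.lcm_dvd ((Nat.dvd_mul_right n s).trans (Nat.dvd_lcm_left ..))
      ((Nat.dvd_mul_right m p).trans (Nat.dvd_lcm_right ..))
  have hx := Nat.mul_div_cancel' (Nat.dvd_lcm_left n m)
  have hz := Nat.mul_div_cancel' hRT
  have hk := Nat.mul_div_cancel' (Nat.dvd_lcm_left (a * s) (b * p))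
  have hl := Nat.mul_div_cancel' (Nat.dvd_lcm_right (a * s) (b * p))
  have hx0 := Nat.div_pos (Nat.le_of_dvd hR (Nat.dvd_lcm_left n m)) hn
  have hy0 := Nat.div_pos (Nat.le_of_dvd hR (Nat.dvd_lcm_right n m)) hm
  have hz0 := Nat.div_pos (Nat.le_of_dvd hT hRT) hR
  have hk0 := Nat.div_pos (Nat.le_of_dvd hL (Nat.dvd_lcm_left (a * s) (b * p))) (by positivity)
  have hl0 := Nat.div_pos (Nat.le_of_dvd hL (Nat.dvd_lcm_right (a * s) (b * p))) (by positivity)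
  have hLn := lcm_mul_eq_of_ratio hratio s p
  change staM (padK (.ofMatrix A₀) s) (padK (.ofMatrix B₀) p) = padK (.ofMatrix (_ + _)) _
  have hrow : Nat.lcm (a * s) (b * p) =
      a * (Nat.lcm n m / n) * (Nat.lcm (n * s) (m * p) / Nat.lcm n m) := by
    apply Nat.eq_of_mul_eq_mul_right hn
    rw [hLn, ← hz]
    nth_rw 1 [← hx]
    rw [hz]
    ring
  have hsk : s * (Nat.lcm (a * s) (b * p) / (a * s)) =
      Nat.lcm n m / n * (Nat.lcm (n * s) (m * p) / Nat.lcm n m) := by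
    apply Nat.eq_of_mul_eq_mul_left ha
    rw [← mul_assoc, hk, hrow, mul_assoc]
  have hpl : p * (Nat.lcm (a * s) (b * p) / (b * p)) =
      Nat.lcm n m / m * (Nat.lcm (n * s) (m * p) / Nat.lcm n m) := by
    apply Nat.eq_of_mul_eq_mul_left hb
    rw [← mul_assoc, hl, hrow, ← mul_assoc, h1]
  refine MatR.ext_toFun hrow ?_ fun i hi j hj => ?_
  · change n * s * (Nat.lcm (a * s) (b * p) / (a * s)) = n * _ * _
    rw [mul_assoc, hsk, mul_assoc]
  · rw [toFun_staM _ _ hi hj, toFun_padK_add _ _ hz0, ofMatrix_castM]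
    change toFun (padK (padK _ s) (Nat.lcm (a * s) (b * p) / (a * s))) i j +
        toFun (padK (padK _ p) (Nat.lcm (a * s) (b * p) / (b * p))) i j =
      toFun (padK (padK (.ofMatrix A₀) _) _) i j + toFun (padK (padK (.ofMatrix B₀) _) _) i j
    rw [padK_padK _ hs hk0, padK_padK _ hp hl0, padK_padK _ hx0 hz0, padK_padK _ hy0 hz0, hsk, hpl]
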